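/- arXiv:2009.13316 — 11 statements merged into one kernel-verified Lean document; each statement's English description precedes it below -/
import Mathlib

section
/- Let α ≥ 1 be a real number and let (u, t, p) be a job with t ≥ 0 and 0 ≤ p ≤ u. If u ≥ α·t, then t + p ≤ (1 + 1/α)·min(u, t + p). -/
/-- Proposition 2(b): if a job `(u, t, p)` is tested (i.e. `u ≥ α·t`), then its
algorithmic running time `t + p` is at most `(1 + 1/α)` times its optimal
running time `min(u, t + p)`. -/
theorem tested_job_alg_time_le
    (α u t p : ℝ) (hα : 1 ≤ α) (ht : 0 ≤ t) (hp : 0 ≤ p) (hpu : p ≤ u)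
    (htest : α * t ≤ u) :
    t + p ≤ (1 + 1 / α) * min u (t + p) := by
  have hα_pos : 0 < α := by linarith
  rcases min_choice u (t + p) with h | h <;> rw [h, add_mul, one_mul, one_div_mul_eq_div]
  · have ht_le : t ≤ u / α := (le_div_iff₀' hα_pos).2 htest
    linarith
  · have h_nonneg : 0 ≤ (t + p) / α := by positivity
    linarith
end

section
/- Let α ≥ 1, β ≥ 1 be reals and let (u_j, t_j, p_j) and (u_k, t_k, p_k) be jobs with t_j, t_k ≥ 0, 0 ≤ p_j ≤ u_j and 0 ≤ p_k ≤ u_k, and suppose u_j < α·t_j (job j is run untested). Define c_N = u_k if u_k ≤ u_j and c_N = 0 otherwise; define c_T = (t_k + p_k if p_k ≤ u_j, else t_k) if β·t_k ≤ u_j, and c_T = 0 if β·t_k > u_j. Then max(c_N, c_T) ≤ (1 + 1/β)·α·min(u_j, t_j + p_j). -/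
/-- Contribution Lemma, untested-`j` half (inequality (4)): the contribution of
any job `k` to the completion time of an untested job `j` is at most
`(1 + 1/β)·α·min(u_j, t_j + p_j)`. -/
theorem contribution_to_untested_job
    (α β uj tj pj uk tk pk : ℝ) (hα : 1 ≤ α) (hβ : 1 ≤ β)
    (htj : 0 ≤ tj) (hpj : 0 ≤ pj) (hpuj : pj ≤ uj)
    (htk : 0 ≤ tk) (hpk : 0 ≤ pk) (hpuk : pk ≤ uk)
    (huntested : uj < α * tj)
    (cN cT : ℝ)
    (hcN : cN = if uk ≤ uj then uk else 0)
    (hcT : cT = if β * tk ≤ uj then (if pk ≤ uj then tk + pk else tk) else 0) :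
    max cN cT ≤ (1 + 1 / β) * α * min uj (tj + pj) := by
  have huj : 0 ≤ uj := hpj.trans hpuj
  have hβ0 : 0 < β := by linarith
  have hmin : uj ≤ α * min uj (tj + pj) := by
    rcases min_choice uj (tj + pj) with h | h <;> rw [h] <;> nlinarith
  have hdiv : 0 ≤ uj / β := by positivity
  have hbound : uj + uj / β ≤ (1 + 1 / β) * α * min uj (tj + pj) :=
    calc uj + uj / β = (1 + 1 / β) * uj := by ring
      _ ≤ (1 + 1 / β) * (α * min uj (tj + pj)) := by gcongr
      _ = (1 + 1 / β) * α * min uj (tj + pj) := by ring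
  have htest : β * tk ≤ uj → tk ≤ uj / β := fun h => (le_div_iff₀' hβ0).2 h
  refine le_trans (max_le ?_ ?_) hbound
  · rw [hcN]
    split_ifs <;> linarith
  · rw [hcT]
    split_ifs with h
    · linarith [htest h]
    · linarith [htest h]
    · linarith
end

section
/- Let α ≥ 1, β ≥ 1 be reals and let (u_j, t_j, p_j) and (u_k, t_k, p_k) be jobs with t_j, t_k ≥ 0, 0 ≤ p_j ≤ u_j and 0 ≤ p_k ≤ u_k, and suppose u_j ≥ α·t_j (job j is tested). Define c_N = u_k if u_k ≤ β·t_j or u_k ≤ p_j, and c_N = 0 otherwise. Define c_T as follows: if t_k ≤ t_j, then c_T = t_k + p_k when p_k ≤ β·t_j, c_T = t_k + p_k when p_k > β·t_j and p_k ≤ p_j, and c_T = t_k when p_k > β·t_j and p_k > p_j; if t_k > t_j, then c_T = t_k + p_k when β·t_k ≤ p_j and p_k ≤ p_j, c_T = t_k when β·t_k ≤ p_j and p_k > p_j, and c_T = 0 when β·t_k > p_j. Then max(c_N, c_T) ≤ max(1 + 1/α, 1 + β, 1 + 1/β)·min(u_j, t_j + p_j). -/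
/-- Contribution Lemma, tested-`j` half (inequality (5)): the contribution of
any job `k` to the completion time of a tested job `j` is at most
`max(1 + 1/α, 1 + β, 1 + 1/β)·min(u_j, t_j + p_j)`. -/
theorem contribution_to_tested_job
    (α β uj tj pj uk tk pk : ℝ) (hα : 1 ≤ α) (hβ : 1 ≤ β)
    (htj : 0 ≤ tj) (hpj : 0 ≤ pj) (hpuj : pj ≤ uj)
    (htk : 0 ≤ tk) (hpk : 0 ≤ pk) (hpuk : pk ≤ uk)
    (htested : α * tj ≤ uj)
    (cN cT : ℝ)
    (hcN : cN = if uk ≤ β * tj ∨ uk ≤ pj then uk else 0)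
    (hcT : cT =
      if tk ≤ tj then
        (if pk ≤ β * tj then tk + pk
         else if pk ≤ pj then tk + pk else tk)
      else
        (if β * tk ≤ pj then (if pk ≤ pj then tk + pk else tk) else 0)) :
    max cN cT ≤ max (max (1 + 1 / α) (1 + β)) (1 + 1 / β) * min uj (tj + pj) := by
  have htm : tj ≤ min uj (tj + pj) :=
    le_min (by nlinarith) (by linarith)
  have hpm : pj ≤ min uj (tj + pj) := le_min hpuj (by linarith)
  -- Since `β ≥ 1`, the factor `1 + β` alone suffices.
  have hfactor : (1 + β) * min uj (tj + pj) ≤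
      max (max (1 + 1 / α) (1 + β)) (1 + 1 / β) * min uj (tj + pj) :=
    mul_le_mul_of_nonneg_right ((le_max_right _ _).trans (le_max_left _ _)) (htj.trans htm)
  refine le_trans ?_ hfactor
  generalize min uj (tj + pj) = m at htm hpm
  have hβt : β * tj ≤ β * m := mul_le_mul_of_nonneg_left htm (by linarith)
  have hβm : m ≤ β * m := le_mul_of_one_le_left (htj.trans htm) hβ
  have hβtk : tk ≤ β * tk := le_mul_of_one_le_left htk hβ
  rw [add_mul, one_mul]
  subst hcN hcT
  refine max_le ?_ ?_
  · split_ifs with h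
    · rcases h with h | h <;> linarith
    · linarith
  · split_ifs <;> linarith
end

section
/- Let n be a natural number and let a_1, …, a_n be nonnegative real numbers. Then Σ_{j=1}^n Σ_{k=1}^n min(a_j, a_k) ≤ 2·Σ_{j=1}^n j·a_j. -/
/-- Round Robin analysis: for nonnegative reals `a_1, …, a_n`,
`Σ_{j=1}^n Σ_{k=1}^n min(a_j, a_k) ≤ 2·Σ_{j=1}^n j·a_j`. -/
theorem sum_sum_min_le_two_sum_weighted
    (n : ℕ) (a : ℕ → ℝ) (ha : ∀ j ∈ Finset.Icc 1 n, 0 ≤ a j) :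
    ∑ j ∈ Finset.Icc 1 n, ∑ k ∈ Finset.Icc 1 n, min (a j) (a k) ≤
      2 * ∑ j ∈ Finset.Icc 1 n, (j : ℝ) * a j := by
  induction n with
  | zero => simp
  | succ n ih =>
    have ih' := ih fun j hj => ha j (Finset.Icc_subset_Icc_right n.le_succ hj)
    have hlast : 0 ≤ a (n + 1) := ha (n + 1) (by simp)
    have hcol : ∑ j ∈ Finset.Icc 1 n, min (a j) (a (n + 1)) ≤ n * a (n + 1) := by
      simpa using Finset.sum_le_card_nsmul (Finset.Icc 1 n) (fun j => min (a j) (a (n + 1)))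
        (a (n + 1)) fun j _ => min_le_right _ _
    have hrow : ∑ k ∈ Finset.Icc 1 n, min (a (n + 1)) (a k) ≤ n * a (n + 1) := by
      simpa only [min_comm] using hcol
    simp only [Finset.sum_Icc_succ_top (Nat.le_add_left 1 n), Finset.sum_add_distrib, min_self]
    push_cast
    linarith
end

section
/- Let φ = (1 + √5)/2 and let n jobs (u_j, t_j, p_j), 1 ≤ j ≤ n, be given with t_j ≥ 0 and 0 ≤ p_j ≤ u_j. Define a_j = t_j + p_j if u_j ≥ φ·t_j and a_j = u_j otherwise, and ρ_j = min(u_j, t_j + p_j). Then Σ_{j=1}^n Σ_{k=1}^n min(a_j, a_k) ≤ 2φ·Σ_{j=1}^n j·ρ_j. -/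
/-- The pairwise minima of a finite sequence are bounded by charging each pair to its larger
index. -/
lemma sum_sum_min_le (a : ℕ → ℝ) (n : ℕ) :
    ∑ j ∈ Finset.Icc 1 n, ∑ k ∈ Finset.Icc 1 n, min (a j) (a k) ≤
      ∑ j ∈ Finset.Icc 1 n, (2 * (j : ℝ) - 1) * a j := by
  induction n with
  | zero => simp
  | succ n ih =>
    have hrow : ∑ k ∈ Finset.Icc 1 n, min (a (n + 1)) (a k) ≤ n * a (n + 1) :=
      (Finset.sum_le_sum fun k _ => min_le_left (a (n + 1)) (a k)).trans_eq (by simp)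
    have hcol : ∑ j ∈ Finset.Icc 1 n, min (a j) (a (n + 1)) ≤ n * a (n + 1) :=
      (Finset.sum_le_sum fun j _ => min_le_right (a j) (a (n + 1))).trans_eq (by simp)
    simp only [Finset.sum_Icc_succ_top (Nat.le_add_left 1 n), Finset.sum_add_distrib, min_self]
    push_cast
    linarith

/-- The golden-ratio testing rule loses at most a factor `φ` on each job. -/
lemma golden_test_le {u t p : ℝ} (ht : 0 ≤ t) (hp : 0 ≤ p) (hpu : p ≤ u) :
    (if Real.goldenRatio * t ≤ u then t + p else u) ≤
      Real.goldenRatio * min u (t + p) := by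
  have hone := Real.one_lt_goldenRatio
  have hsq := Real.goldenRatio_sq
  rw [mul_min_of_nonneg _ _ Real.goldenRatio_pos.le]
  split_ifs with h
  · exact le_min (by nlinarith) (by nlinarith)
  · exact le_min (by nlinarith) (by nlinarith)

/-- Core of Theorem 3: the Golden Round Robin algorithm (testing job `j` iff
`u_j ≥ φ·t_j`, with algorithmic running times `a_j`) satisfies
`Σ_j Σ_k min(a_j, a_k) ≤ 2φ·Σ_j j·ρ_j`, where `ρ_j = min(u_j, t_j + p_j)`. -/
theorem golden_round_robin_bound
    (φ : ℝ) (hφ : φ = (1 + Real.sqrt 5) / 2)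
    (n : ℕ) (u t p : ℕ → ℝ)
    (ht : ∀ j ∈ Finset.Icc 1 n, 0 ≤ t j)
    (hp : ∀ j ∈ Finset.Icc 1 n, 0 ≤ p j)
    (hpu : ∀ j ∈ Finset.Icc 1 n, p j ≤ u j)
    (a ρ : ℕ → ℝ)
    (ha : ∀ j, a j = if φ * t j ≤ u j then t j + p j else u j)
    (hρ : ∀ j, ρ j = min (u j) (t j + p j)) :
    ∑ j ∈ Finset.Icc 1 n, ∑ k ∈ Finset.Icc 1 n, min (a j) (a k) ≤
      2 * φ * ∑ j ∈ Finset.Icc 1 n, (j : ℝ) * ρ j := by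
  obtain rfl : φ = Real.goldenRatio := hφ
  refine (sum_sum_min_le a n).trans ?_
  rw [Finset.mul_sum]
  refine Finset.sum_le_sum fun j hj => ?_
  have hle : a j ≤ Real.goldenRatio * ρ j := by
    rw [ha, hρ]
    exact golden_test_le (ht j hj) (hp j hj) (hpu j hj)
  have hnonneg : 0 ≤ a j := by
    have := ht j hj
    have := hp j hj
    have := hpu j hj
    rw [ha]
    split_ifs <;> linarith
  calc (2 * (j : ℝ) - 1) * a j ≤ 2 * j * a j := by linarith
    _ ≤ 2 * j * (Real.goldenRatio * ρ j) := by gcongr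
    _ = 2 * Real.goldenRatio * (j * ρ j) := by ring
end

section
/- There exist a real number β ≥ 1 and a function p : ℝ → ℝ such that for every real r ≥ 1 one has 0 ≤ p(r) ≤ 1 and both of the following inequalities hold: (2 + 1/β)·(1 − p(r)) + (1/r + 1 + max((1 + β)/r, 1 + 1/β, 1 + 1/r))·p(r) ≤ 3.3794, and ((2 + β) − (2 + 1/β)·r)·p(r) + (2 + 1/β)·r ≤ 3.3794. -/
/-- Clearing denominators in a bound of the form `B (1 - p) + c p ≤ R`, for `p = n / d`
and `c = a / r`. -/
lemma mix_le_of_cleared {B R a r n d : ℝ} (hr : 0 < r) (hd : 0 < d)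
    (h : (a - B * r) * n ≤ (R - B) * (r * d)) :
    B * (1 - n / d) + a / r * (n / d) ≤ R := by
  have key : B * (1 - n / d) + a / r * (n / d) = B + (a - B * r) * n / (r * d) := by
    field_simp
    ring
  have : (a - B * r) * n / (r * d) ≤ R - B := (div_le_iff₀ (by positivity)).2 h
  linarith

/-- Lemma 2: there exist `β ≥ 1` and a probability function `p(r) ∈ [0,1]` such
that both case bounds on `λ_j(β,p)/ρ_j` are at most `3.3794` for all `r ≥ 1`. -/
theorem randomized_sort_parameter_choice :
    ∃ β : ℝ, 1 ≤ β ∧ ∃ p : ℝ → ℝ, ∀ r : ℝ, 1 ≤ r →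
      0 ≤ p r ∧ p r ≤ 1 ∧
      (2 + 1 / β) * (1 - p r) +
        (1 / r + 1 + max (max ((1 + β) / r) (1 + 1 / β)) (1 + 1 / r)) * p r ≤
        3.3794 ∧
      ((2 + β) - (2 + 1 / β) * r) * p r + (2 + 1 / β) * r ≤ 3.3794 := by
  -- Where `p` is positive it is chosen to make the second bound an equality.
  refine ⟨1.2574, by norm_num, fun r => if (2 + 1 / 1.2574) * r ≤ 3.3794 then 0 else
    ((2 + 1 / 1.2574) * r - 3.3794) / ((2 + 1 / 1.2574) * r - 3.2574), fun r hr => ?_⟩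
  dsimp only
  split_ifs with h
  · norm_num at h ⊢
    linarith
  · push Not at h
    have hr0 : 0 < r := by linarith
    have hd : 0 < (2 + 1 / 1.2574) * r - 3.2574 := by linarith
    refine ⟨div_nonneg (by linarith) hd.le, (div_le_one hd).2 (by linarith), ?_, ?_⟩
    · rcases max_choice (max ((1 + 1.2574) / r) (1 + 1 / 1.2574)) (1 + 1 / r) with e | e <;>
        rw [e]
      · rcases max_choice ((1 + 1.2574) / r) (1 + 1 / 1.2574) with e | e <;> rw [e]
        · rw [show 1 / r + 1 + (1 + 1.2574) / r = (3.2574 + r) / r by field_simp; ring]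
          apply mix_le_of_cleared hr0 hd
          norm_num at h ⊢
          nlinarith [sq_nonneg (r - 1.4)]
        · rw [show 1 / r + 1 + (1 + 1 / 1.2574) = (1 + (2 + 1 / 1.2574) * r) / r by
            field_simp; ring]
          apply mix_le_of_cleared hr0 hd
          norm_num at h ⊢
          nlinarith [sq_nonneg (r - 1.43865)]
      · rw [show 1 / r + 1 + (1 + 1 / r) = (2 + 2 * r) / r by field_simp; ring]
        apply mix_le_of_cleared hr0 hd
        norm_num at h ⊢
        nlinarith [sq_nonneg (r - 1.4)]
    · have e : (2 + 1.2574 - (2 + 1 / 1.2574) * r) *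
          (((2 + 1 / 1.2574) * r - 3.3794) / ((2 + 1 / 1.2574) * r - 3.2574)) =
          -((2 + 1 / 1.2574) * r - 3.3794) := by
        rw [show 2 + 1.2574 - (2 + 1 / 1.2574) * r = -((2 + 1 / 1.2574) * r - 3.2574) by ring,
          neg_mul, mul_div_cancel₀ _ hd.ne']
      linarith
end

section
/- There exist a real number β ≥ 1 and a function q : ℝ → ℝ with 0 ≤ q(x) ≤ 1 for all x, such that for all reals u, t, p with t > 0 and 0 ≤ p ≤ u: (1 − q(u/t))·(u + (1 + 1/β)·u) + q(u/t)·(t + p + max((1 + β)·t, (1 + 1/β)·p, t + p)) ≤ 3.3794·min(u, t + p). -/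
/-- The testing probability that makes the bound tight for jobs with processing time zero
(for the parameter `β = 44 / 35`). -/
noncomputable def testProb (x : ℝ) : ℝ :=
  if 123 / 44 * x ≤ 3.3794 then 0 else (123 / 44 * x - 3.3794) / (123 / 44 * x - 114 / 35)

theorem testProb_of_le {x : ℝ} (hx : 123 / 44 * x ≤ 3.3794) : testProb x = 0 := if_pos hx

theorem testProb_of_lt {x : ℝ} (hx : 3.3794 < 123 / 44 * x) :
    testProb x = (123 / 44 * x - 3.3794) / (123 / 44 * x - 114 / 35) := if_neg hx.not_ge

theorem testProb_mem_Icc (x : ℝ) : 0 ≤ testProb x ∧ testProb x ≤ 1 := by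
  rcases le_or_gt (123 / 44 * x) 3.3794 with hx | hx
  · simp [testProb_of_le hx]
  · have hD : 0 < 123 / 44 * x - 114 / 35 := by norm_num at hx ⊢; linarith
    rw [testProb_of_lt hx]
    exact ⟨div_nonneg (by linarith) hD.le, (div_le_one hD).2 (by norm_num; linarith)⟩

/-- The per-job cost of a job with processing time zero. -/
theorem testProb_zero_eq {x : ℝ} (hx : 3.3794 < 123 / 44 * x) :
    (1 - testProb x) * (123 / 44 * x) + testProb x * (114 / 35) = 3.3794 := by
  have hD : 123 / 44 * x - 114 / 35 ≠ 0 := by norm_num at hx ⊢; linarith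
  have h := div_mul_cancel₀ (123 / 44 * x - 3.3794) hD
  rw [← testProb_of_lt hx] at h
  linarith

theorem testProb_le_mul {x : ℝ} (hx : 3.3794 < 123 / 44 * x) :
    testProb x ≤ (3.3794 - 123 / 44) * x := by
  have hD : 0 < 123 / 44 * x - 114 / 35 := by norm_num at hx ⊢; linarith
  rw [testProb_of_lt hx, div_le_iff₀ hD]
  norm_num
  nlinarith [sq_nonneg (x - 1.4388)]

theorem testProb_mul_le {x : ℝ} (hx : 3.3794 < 123 / 44 * x) (hx' : x ≤ 44 / 35) :
    testProb x * (114 / 35 - 79 / 44 * x) ≤ (3.3794 - 123 / 44) * x := by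
  have hD : 0 < 123 / 44 * x - 114 / 35 := by norm_num at hx ⊢; linarith
  rw [testProb_of_lt hx, div_mul_eq_mul_div, div_le_iff₀ hD]
  norm_num at hx ⊢
  nlinarith [mul_nonneg (sub_nonneg.2 hx.le) (sub_nonneg.2 hx')]

/-- The per-job cost of a job whose processing time equals its upper limit. -/
theorem testProb_full_le {x : ℝ} (hx : 3.3794 < 123 / 44 * x) :
    (1 - testProb x) * (123 / 44 * x) +
      testProb x * (1 + x + max (max (79 / 35) (79 / 44 * x)) (1 + x)) ≤ 3.3794 * x := by
  have hq := (testProb_mem_Icc x).1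
  rcases le_total x (44 / 35) with h | h
  · rw [max_eq_left (a := (79 / 35 : ℝ)) (by linarith), max_eq_left (by linarith)]
    linarith [testProb_mul_le hx h]
  · rw [max_eq_right (a := (79 / 35 : ℝ)) (by linarith), max_eq_left (by linarith)]
    linarith [testProb_le_mul hx]

/-- The per-job bound, normalized to testing time one. -/
theorem testProb_cost_le {x y : ℝ} (hy : 0 ≤ y) (hyx : y ≤ x) :
    (1 - testProb x) * (123 / 44 * x) +
      testProb x * (1 + y + max (max (79 / 35) (79 / 44 * y)) (1 + y)) ≤
      3.3794 * min x (1 + y) := by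
  obtain ⟨hq0, hq1⟩ := testProb_mem_Icc x
  rcases le_or_gt (123 / 44 * x) 3.3794 with hx | hx
  · rw [testProb_of_le hx, mul_min_of_nonneg _ _ (by norm_num)]
    refine le_min ?_ ?_ <;> norm_num at hx ⊢ <;> linarith
  rw [mul_min_of_nonneg _ _ (by norm_num)]
  refine le_min ?_ ?_
  · refine le_trans ?_ (testProb_full_le hx)
    gcongr
  · have hmax : max (max (79 / 35) (79 / 44 * y)) (1 + y) ≤ 79 / 35 + 79 / 44 * y :=
      max_le (max_le (by linarith) (by linarith)) (by linarith)
    have hqy : testProb x * y ≤ y := mul_le_of_le_one_left hy hq1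
    have hqm := mul_le_mul_of_nonneg_left hmax hq0
    have h0 := testProb_zero_eq hx
    norm_num at h0 ⊢
    linarith

/-- Core of Theorem 5: there exist `β ≥ 1` and a testing probability
`q : ℝ → [0,1]` such that for every job `(u, t, p)` the expected per-job cost
`λ_j(β,q)` is at most `3.3794·min(u, t + p)`. -/
theorem randomized_sort_per_job_bound :
    ∃ β : ℝ, 1 ≤ β ∧ ∃ q : ℝ → ℝ, (∀ x, 0 ≤ q x ∧ q x ≤ 1) ∧
      ∀ u t p : ℝ, 0 < t → 0 ≤ p → p ≤ u →
        (1 - q (u / t)) * (u + (1 + 1 / β) * u) +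
          q (u / t) * (t + p + max (max ((1 + β) * t) ((1 + 1 / β) * p)) (t + p)) ≤
          3.3794 * min u (t + p) := by
  refine ⟨44 / 35, by norm_num, testProb, testProb_mem_Icc, fun u t p ht hp hpu => ?_⟩
  obtain ⟨x, rfl⟩ : ∃ x, u = x * t := ⟨u / t, (div_mul_cancel₀ u ht.ne').symm⟩
  obtain ⟨y, rfl⟩ : ∃ y, p = y * t := ⟨p / t, (div_mul_cancel₀ p ht.ne').symm⟩
  have h := mul_le_mul_of_nonneg_right
    (testProb_cost_le (nonneg_of_mul_nonneg_left hp ht) (le_of_mul_le_mul_right hpu ht)) ht.le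
  have hmin : min (x * t) (t + y * t) = min x (1 + y) * t := by
    rw [min_mul_of_nonneg _ _ ht.le, add_mul, one_mul]
  have hmax : max (max ((1 + 44 / 35) * t) ((1 + 1 / (44 / 35)) * (y * t))) (t + y * t) =
      max (max (79 / 35) (79 / 44 * y)) (1 + y) * t := by
    rw [max_mul_of_nonneg _ _ ht.le, max_mul_of_nonneg _ _ ht.le]
    congr 1
    · congr 1 <;> ring
    · ring
  rw [mul_div_cancel_right₀ x ht.ne', hmin, hmax]
  linarith
end

section
/- Let φ = (1 + √5)/2 and let n jobs (u_j, t_j, p_j), 1 ≤ j ≤ n, be given with t_j ≥ 0 and 0 ≤ p_j ≤ u_j. Then Σ_{j=1}^n (t_j + p_j if u_j ≥ φ·t_j, else u_j) ≤ φ·Σ_{j=1}^n min(u_j, t_j + p_j). -/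
/-- On a single job, testing exactly when `φ * t ≤ u` costs at most `φ` times the optimal
running time, for any `φ ≥ 1` with `φ ^ 2 = φ + 1`. -/
lemma running_time_le_mul_min {φ u t p : ℝ} (hφ : 1 ≤ φ) (hsq : φ ^ 2 = φ + 1)
    (ht : 0 ≤ t) (hp : 0 ≤ p) (hpu : p ≤ u) :
    (if φ * t ≤ u then t + p else u) ≤ φ * min u (t + p) := by
  rw [mul_min_of_nonneg _ _ (by linarith), le_min_iff]
  split_ifs with h
  · have ht_le : t ≤ (φ - 1) * u :=
      calc t = (φ - 1) * (φ * t) := by linear_combination -t * hsq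
        _ ≤ (φ - 1) * u := mul_le_mul_of_nonneg_left h (by linarith)
    exact ⟨by linarith, le_mul_of_one_le_left (by linarith) hφ⟩
  · exact ⟨le_mul_of_one_le_left (by linarith) hφ, by nlinarith⟩

/-- Upper-bound part of Theorem 6: the makespan of the algorithm that tests job
`j` iff `u_j ≥ φ·t_j` is at most `φ` times the optimal makespan
`Σ_j min(u_j, t_j + p_j)`, where `φ = (1 + √5)/2`. -/
theorem makespan_golden_ratio_competitive
    (φ : ℝ) (hφ : φ = (1 + Real.sqrt 5) / 2)
    (n : ℕ) (u t p : ℕ → ℝ)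
    (ht : ∀ j ∈ Finset.Icc 1 n, 0 ≤ t j)
    (hp : ∀ j ∈ Finset.Icc 1 n, 0 ≤ p j)
    (hpu : ∀ j ∈ Finset.Icc 1 n, p j ≤ u j) :
    ∑ j ∈ Finset.Icc 1 n, (if φ * t j ≤ u j then t j + p j else u j) ≤
      φ * ∑ j ∈ Finset.Icc 1 n, min (u j) (t j + p j) := by
  have h_eq : φ = Real.goldenRatio := hφ
  rw [Finset.mul_sum]
  refine Finset.sum_le_sum fun j hj =>
    running_time_le_mul_min ?_ ?_ (ht j hj) (hp j hj) (hpu j hj)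
  · exact h_eq ▸ Real.one_lt_goldenRatio.le
  · exact h_eq ▸ Real.goldenRatio_sq
end

section
/- Let φ = (1 + √5)/2. For every Boolean decision d (whether to test a single job with upper limit u = φ and testing time t = 1) there exists a real p with 0 ≤ p ≤ φ such that (1 + p if d is true, else φ) ≥ φ·min(φ, 1 + p). -/
/-- Lower-bound part of Theorem 6: for the single job with `u = φ`, `t = 1`,
whatever the algorithm decides (`d = true` means test), the adversary can pick
a processing time `p ∈ [0, φ]` making the algorithm's makespan at least `φ`
times the optimum `min(φ, 1 + p)`. -/
theorem makespan_deterministic_lower_bound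
    (φ : ℝ) (hφ : φ = (1 + Real.sqrt 5) / 2) (d : Bool) :
    ∃ p : ℝ, 0 ≤ p ∧ p ≤ φ ∧
      (if d then 1 + p else φ) ≥ φ * min φ (1 + p) := by
  have hφ0 : 0 ≤ φ := by rw [hφ]; positivity
  have hsq : φ * φ = 1 + φ := by
    rw [hφ]
    linarith [Real.mul_self_sqrt (show (0 : ℝ) ≤ 5 by norm_num)]
  cases d with
  | true =>
    refine ⟨φ, hφ0, le_rfl, ?_⟩
    calc φ * min φ (1 + φ) ≤ φ * φ := mul_le_mul_of_nonneg_left (min_le_left _ _) hφ0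
      _ = 1 + φ := hsq
  | false =>
    refine ⟨0, le_rfl, hφ0, ?_⟩
    calc φ * min φ (1 + 0) ≤ φ * (1 + 0) := mul_le_mul_of_nonneg_left (min_le_right _ _) hφ0
      _ = φ := by ring
end

section
/- Let u, t, p be reals with t > 0, t ≤ u and 0 ≤ p ≤ u, set r = u/t and q = 1 − 1/(r² − r + 1). Then q·(t + p) + (1 − q)·u ≤ (4/3)·min(u, t + p). -/
/-- Upper-bound part of Theorem 7: testing a job with ratio `r = u/t` with
probability `q = 1 − 1/(r² − r + 1)` yields expected makespan at most
`(4/3)·min(u, t + p)`. -/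
theorem randomized_makespan_per_job_bound
    (u t p r q : ℝ) (ht : 0 < t) (htu : t ≤ u) (hp : 0 ≤ p) (hpu : p ≤ u)
    (hr : r = u / t) (hq : q = 1 - 1 / (r ^ 2 - r + 1)) :
    q * (t + p) + (1 - q) * u ≤ (4 / 3) * min u (t + p) := by
  have hu : u = r * t := by rw [hr]; field_simp
  have hr1 : 1 ≤ r := by rw [hr]; exact (one_le_div ht).2 htu
  have hD : 0 < r ^ 2 - r + 1 := by nlinarith
  have hrr : 0 ≤ r ^ 2 - r := by nlinarith
  have hlhs : q * (t + p) + (1 - q) * u =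
      ((r ^ 2 - r) * (t + p) + r * t) / (r ^ 2 - r + 1) := by
    have hqD : q * (r ^ 2 - r + 1) = r ^ 2 - r := by
      rw [hq, sub_mul, div_mul_cancel₀ _ hD.ne']
      ring
    rw [hu, eq_div_iff hD.ne']
    linear_combination (t + p - r * t) * hqD
  rw [hlhs, div_le_iff₀ hD]
  rcases min_choice u (t + p) with h | h <;> rw [h]
  · have hpq : (r ^ 2 - r) * p ≤ (r ^ 2 - r) * (r * t) :=
      mul_le_mul_of_nonneg_left (hu ▸ hpu) hrr
    have hsq : 0 ≤ r * t * (r - 2) ^ 2 := by positivity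
    rw [hu]
    linarith
  · have hpq : 0 ≤ (r ^ 2 - r) * p := mul_nonneg hrr hp
    have hsq : 0 ≤ t * (r - 2) ^ 2 := by positivity
    linarith
end

section
/- Let n be a natural number and let u_1, …, u_n, p_1, …, p_n be reals with u_j ≥ 2 and 0 ≤ p_j ≤ u_j for all j. Then n² + Σ_{j=1}^n j·p_j ≤ 2·Σ_{j=1}^n j·min(u_j, 1 + p_j). -/
/-- Twice the sum of the first `n` positive integers is at least `n ^ 2`. -/
theorem sq_le_sum_Icc_mul_two (n : ℕ) :
    (n : ℝ) ^ 2 ≤ ∑ j ∈ Finset.Icc 1 n, (j : ℝ) * 2 := by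
  induction n with
  | zero => simp
  | succ k ih =>
    rw [Finset.sum_Icc_succ_top (by omega)]
    push_cast
    linarith

/-- The optimal running time satisfies `2 + p ≤ 2 * min u (1 + p)`. -/
theorem two_add_le_two_mul_min {u p : ℝ} (hu : 2 ≤ u) (hp : 0 ≤ p) (hpu : p ≤ u) :
    2 + p ≤ 2 * min u (1 + p) := by
  rcases min_choice u (1 + p) with h | h <;> rw [h] <;> linarith

/-- Core of the Force Testing analysis (unit testing times): for jobs with
`u_j ≥ 2` and `0 ≤ p_j ≤ u_j`,
`n² + Σ_j j·p_j ≤ 2·Σ_j j·min(u_j, 1 + p_j)`. -/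
theorem force_testing_bound
    (n : ℕ) (u p : ℕ → ℝ)
    (hu : ∀ j ∈ Finset.Icc 1 n, 2 ≤ u j)
    (hp : ∀ j ∈ Finset.Icc 1 n, 0 ≤ p j)
    (hpu : ∀ j ∈ Finset.Icc 1 n, p j ≤ u j) :
    (n : ℝ) ^ 2 + ∑ j ∈ Finset.Icc 1 n, (j : ℝ) * p j ≤
      2 * ∑ j ∈ Finset.Icc 1 n, (j : ℝ) * min (u j) (1 + p j) := by
  calc
    (n : ℝ) ^ 2 + ∑ j ∈ Finset.Icc 1 n, (j : ℝ) * p j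
      ≤ ∑ j ∈ Finset.Icc 1 n, (j : ℝ) * (2 + p j) := by
        simp only [mul_add, Finset.sum_add_distrib]
        gcongr
        exact sq_le_sum_Icc_mul_two n
    _ ≤ ∑ j ∈ Finset.Icc 1 n, (j : ℝ) * (2 * min (u j) (1 + p j)) := by
        refine Finset.sum_le_sum fun j hj => mul_le_mul_of_nonneg_left ?_ j.cast_nonneg
        exact two_add_le_two_mul_min (hu j hj) (hp j hj) (hpu j hj)
    _ = 2 * ∑ j ∈ Finset.Icc 1 n, (j : ℝ) * min (u j) (1 + p j) := by
        simp only [Finset.mul_sum, mul_left_comm]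
end
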